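/- Explicit O(1/n) rate for the pre-relaxed block Jacobi method: under the equal-size M_s × N_s rectangular decomposition with color classes S_1,…,S_{N_c}, let p⁽⁰⁾ ∈ C and p⁽ⁿ⁺¹⁾ = Σ_{k=1}^{N_c} R_k* t_k⁽ⁿ⁾, where t_k⁽ⁿ⁾ ∈ C_k is any minimizer of p_k ↦ F_k(N_c p_k − (N_c − 1) R_k p⁽ⁿ⁾; p⁽ⁿ⁾) over C_k, and let p* be a minimizer of F over C. Then for any n ≥ 1, F(p⁽ⁿ⁾) − F(p*) ≤ (N_c/n)[F(p⁽⁰⁾) − F(p*) + 2c₁], where c₁ = 7(M N_s + M_s N − (11/7) M_s N_s). -/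

import Mathlib

open Finset

noncomputable section

/-- The discrete image domain of `M × N` pixels. -/
abbrev Idx (M N : ℕ) := Fin M × Fin N

/-- The discrete divergence operator `div : W → V`, the negative adjoint of
the discrete gradient. -/
def divOp {M N : ℕ} (p : Idx M N → ℝ × ℝ) : Idx M N → ℝ := fun x =>
  ((if (x.1 : ℕ) + 1 < M then (p x).1 else 0)
    - (if 1 ≤ (x.1 : ℕ) then
        (p (⟨(x.1 : ℕ) - 1, lt_of_le_of_lt (Nat.sub_le _ _) x.1.isLt⟩, x.2)).1 else 0))
  + ((if (x.2 : ℕ) + 1 < N then (p x).2 else 0)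
    - (if 1 ≤ (x.2 : ℕ) then
        (p (x.1, ⟨(x.2 : ℕ) - 1, lt_of_le_of_lt (Nat.sub_le _ _) x.2.isLt⟩)).2 else 0))

/-- The discrete gradient operator `∇ : V → W`. -/
def gradOp {M N : ℕ} (u : Idx M N → ℝ) : Idx M N → ℝ × ℝ := fun x =>
  ((if h : (x.1 : ℕ) + 1 < M then u (⟨(x.1 : ℕ) + 1, h⟩, x.2) - u x else 0),
   (if h : (x.2 : ℕ) + 1 < N then u (x.1, ⟨(x.2 : ℕ) + 1, h⟩) - u x else 0))

/-- Euclidean inner product on `V`. -/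
def innerV {M N : ℕ} (u v : Idx M N → ℝ) : ℝ := ∑ x, u x * v x

/-- Euclidean inner product on `W`. -/
def innerW {M N : ℕ} (p q : Idx M N → ℝ × ℝ) : ℝ :=
  ∑ x, ((p x).1 * (q x).1 + (p x).2 * (q x).2)

/-- Squared Euclidean norm on `V`. -/
def normVsq {M N : ℕ} (u : Idx M N → ℝ) : ℝ := ∑ x, (u x) ^ 2

/-- Max (Euclidean-pointwise) norm on `W`. -/
def normWinf {M N : ℕ} (p : Idx M N → ℝ × ℝ) : ℝ :=
  ⨆ x : Idx M N, Real.sqrt ((p x).1 ^ 2 + (p x).2 ^ 2)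

/-- The dual ROF energy `F(p) = (1/2)‖div p + α f‖₂²`. -/
def F {M N : ℕ} (α : ℝ) (f : Idx M N → ℝ) (p : Idx M N → ℝ × ℝ) : ℝ :=
  (1 / 2) * normVsq (fun x => divOp p x + α * f x)

/-- The gradient of `F`, namely `∇F(q) = div*(div q + α f) = -∇(div q + α f)`. -/
def gradF {M N : ℕ} (α : ℝ) (f : Idx M N → ℝ) (q : Idx M N → ℝ × ℝ) :
    Idx M N → ℝ × ℝ :=
  fun x => - gradOp (fun y => divOp q y + α * f y) x

/-- The constraint set `C = {p ∈ W : |p_{ij}| ≤ 1 ∀ (i,j)}`. -/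
def Cset (M N : ℕ) : Set (Idx M N → ℝ × ℝ) :=
  {p | ∀ x, Real.sqrt ((p x).1 ^ 2 + (p x).2 ^ 2) ≤ 1}

/-- Restriction operator `R_k : W → W_k`. -/
def Rk {M N : ℕ} (S : Finset (Idx M N)) (p : Idx M N → ℝ × ℝ) :
    {x // x ∈ S} → ℝ × ℝ :=
  fun x => p x.1

/-- Extension-by-zero operator `R_k* : W_k → W`. -/
def Ek {M N : ℕ} (S : Finset (Idx M N)) (pk : {x // x ∈ S} → ℝ × ℝ) :
    Idx M N → ℝ × ℝ :=
  fun x => if h : x ∈ S then pk ⟨x, h⟩ else 0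

/-- The orthogonal projection `R_k* R_k : W → W`. -/
def projk {M N : ℕ} (S : Finset (Idx M N)) (p : Idx M N → ℝ × ℝ) :
    Idx M N → ℝ × ℝ :=
  fun x => if x ∈ S then p x else 0

/-- The local constraint set `C_k = R_k C`. -/
def Ck {M N : ℕ} (S : Finset (Idx M N)) : Set ({x // x ∈ S} → ℝ × ℝ) :=
  Rk S '' Cset M N

/-- The local energy `F_k(p_k; r) = F(R_k* p_k + (I - R_k* R_k) r)`. -/
def Fk {M N : ℕ} (α : ℝ) (f : Idx M N → ℝ) (S : Finset (Idx M N))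
    (pk : {x // x ∈ S} → ℝ × ℝ) (r : Idx M N → ℝ × ℝ) : ℝ :=
  F α f (Ek S pk + (r - projk S r))

/-- Euclidean inner product on `W_k`. -/
def innerWk {M N : ℕ} (S : Finset (Idx M N)) (pk qk : {x // x ∈ S} → ℝ × ℝ) : ℝ :=
  ∑ x : {x // x ∈ S}, ((pk x).1 * (qk x).1 + (pk x).2 * (qk x).2)

/-- The distance-like quantity `D(p,q) = Σ_k (1/2)‖div R_k* R_k (p - q)‖₂²`. -/
def Ddist {M N Nc : ℕ} (S : Fin Nc → Finset (Idx M N))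
    (p q : Idx M N → ℝ × ℝ) : ℝ :=
  ∑ k, (1 / 2) * normVsq (divOp (projk (S k) (p - q)))

/-- The rectangular subdomain `Ω_s` of size `m × n` indexed by `s : Fin Ms × Fin Ns`
(for an `M × N` image with `M = Ms * m`, `N = Ns * n`). -/
def block {M N Ms Ns : ℕ} (m n : ℕ) (s : Fin Ms × Fin Ns) : Finset (Idx M N) :=
  Finset.univ.filter fun x => (x.1 : ℕ) / m = (s.1 : ℕ) ∧ (x.2 : ℕ) / n = (s.2 : ℕ)

end

/-- The discrete divergence as a linear map. -/
def divLin (M N : ℕ) : (Idx M N → ℝ × ℝ) →ₗ[ℝ] (Idx M N → ℝ) where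
  toFun := divOp
  map_add' p q := by
    funext x
    simp only [divOp, Pi.add_apply, Prod.fst_add, Prod.snd_add]
    split_ifs <;> ring
  map_smul' c p := by
    funext x
    simp only [divOp, Pi.smul_apply, Prod.smul_fst, Prod.smul_snd, smul_eq_mul, RingHom.id_apply]
    split_ifs <;> ring

/-- The projection `R_k* R_k` as a linear map. -/
def projLin {M N : ℕ} (S : Finset (Idx M N)) :
    (Idx M N → ℝ × ℝ) →ₗ[ℝ] (Idx M N → ℝ × ℝ) where
  toFun := projk S
  map_add' p q := by
    funext x
    simp only [projk, Pi.add_apply]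
    split_ifs <;> simp
  map_smul' c p := by
    funext x
    simp only [projk, Pi.smul_apply, RingHom.id_apply]
    split_ifs <;> simp

/-- The symmetric bilinear form `(p, q) ↦ ⟨L p, L q⟩` of a linear map into a Euclidean space. -/
def gramForm {E ι : Type*} [AddCommGroup E] [Module ℝ E] [Fintype ι] (L : E →ₗ[ℝ] (ι → ℝ)) :
    LinearMap.BilinForm ℝ E :=
  LinearMap.mk₂ ℝ (fun p q => ∑ x, L p x * L q x)
    (fun p p' q => by simp [add_mul, Finset.sum_add_distrib])
    (fun c p q => by simp [Finset.mul_sum, mul_assoc])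
    (fun p q q' => by simp [mul_add, Finset.sum_add_distrib])
    (fun c p q => by simp [Finset.mul_sum, mul_left_comm])

theorem gramForm_apply {E ι : Type*} [AddCommGroup E] [Module ℝ E] [Fintype ι]
    (L : E →ₗ[ℝ] (ι → ℝ)) (p q : E) : gramForm L p q = ∑ x, L p x * L q x := rfl

theorem gramForm_self_nonneg {E ι : Type*} [AddCommGroup E] [Module ℝ E] [Fintype ι]
    (L : E →ₗ[ℝ] (ι → ℝ)) (p : E) : 0 ≤ gramForm L p p :=
  Finset.sum_nonneg fun _ _ => mul_self_nonneg _

/-- Sharp rate of the proximal point method with respect to a positive semidefinite form `Q`. -/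
theorem proximal_point_rate {E : Type*} [AddCommGroup E] [Module ℝ E]
    (Q : LinearMap.BilinForm ℝ E) (hsymm : ∀ u v, Q u v = Q v u) (hpos : ∀ u, 0 ≤ Q u u)
    (G : E → ℝ) (C : Set E) (x : ℕ → E) (hx : ∀ n, x n ∈ C)
    (hvar : ∀ n, ∀ r ∈ C, G (x (n + 1)) ≤ G r + Q (x (n + 1) - x n) (r - x (n + 1)))
    (z : E) (hz : z ∈ C) (n : ℕ) :
    4 * (n : ℝ) * (G (x n) - G z) ≤ Q (x 0 - z) (x 0 - z) := by
  rcases n with _ | n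
  · simpa using hpos (x 0 - z)
  set s : ℕ → E := fun k => x (k + 1) - x k with hs
  set u : ℕ → E := fun k => x k - z with hu
  have hus : ∀ k, u (k + 1) = u k + s k := fun k => by simp only [hu, hs]; abel
  have descent : ∀ k, G (x (k + 1)) ≤ G (x k) - Q (s k) (s k) := fun k => by
    have h := hvar k _ (hx k)
    rw [show x k - x (k + 1) = -s k by simp [hs], map_neg] at h
    exact h
  have to_z : ∀ k, G (x (k + 1)) ≤ G z - Q (s k) (u (k + 1)) := fun k => by
    have h := hvar k _ hz
    rw [show z - x (k + 1) = -u (k + 1) by simp [hu], map_neg] at h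
    exact h
  have step_anti : ∀ k, Q (s (k + 1)) (s (k + 1)) ≤ Q (s k) (s k) := fun k => by
    have h₁ : G (x (k + 1)) ≤ G (x (k + 2)) + Q (s k) (s (k + 1)) := hvar k _ (hx (k + 2))
    have h₂ := descent (k + 1)
    have h₃ := hpos (s k - s (k + 1))
    simp only [map_sub, LinearMap.sub_apply] at h₃
    linarith [hsymm (s k) (s (k + 1))]
  have energy : ∀ k : ℕ, Q (u (k + 1)) (u (k + 1)) + 2 * ((k : ℝ) + 1) * (G (x (k + 1)) - G z)
      + ((k : ℝ) + 1) ^ 2 * Q (s k) (s k) ≤ Q (u 0) (u 0) := by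
    have dist : ∀ k, Q (u k) (u k)
        = Q (u (k + 1)) (u (k + 1)) - 2 * Q (s k) (u (k + 1)) + Q (s k) (s k) := fun k => by
      rw [hus]
      simp only [map_add, LinearMap.add_apply]
      linarith [hsymm (s k) (u k)]
    intro k
    induction k with
    | zero => norm_num; linarith [dist 0, to_z 0]
    | succ k ih =>
      push_cast
      have hk : (0 : ℝ) ≤ k := Nat.cast_nonneg k
      nlinarith [dist (k + 1), to_z (k + 1),
        mul_le_mul_of_nonneg_left (descent (k + 1)) (by linarith : (0 : ℝ) ≤ 2 * (k + 1)),
        mul_le_mul_of_nonneg_left (step_anti k) (by positivity : (0 : ℝ) ≤ ((k : ℝ) + 1) ^ 2)]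
  have amgm := hpos (((n : ℝ) + 1) • s n + u (n + 1))
  simp only [map_add, LinearMap.add_apply, map_smul, LinearMap.smul_apply, smul_eq_mul] at amgm
  have hn : (0 : ℝ) ≤ n := Nat.cast_nonneg n
  have h := mul_le_mul_of_nonneg_left (to_z n) (by linarith : (0 : ℝ) ≤ 2 * (n + 1))
  push_cast
  nlinarith [energy n, hsymm (s n) (u (n + 1))]

theorem F_add {M N : ℕ} (α : ℝ) (f : Idx M N → ℝ) (p q : Idx M N → ℝ × ℝ) :
    F α f (p + q) = F α f p + ∑ x, (divOp p x + α * f x) * divOp q x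
      + (1 / 2) * normVsq (divOp q) := by
  have h : divOp (p + q) = divOp p + divOp q := (divLin M N).map_add p q
  simp only [F, normVsq, h, Pi.add_apply, Finset.mul_sum, ← Finset.sum_add_distrib]
  exact Finset.sum_congr rfl fun x _ => by ring

theorem normVsq_nonneg {M N : ℕ} (v : Idx M N → ℝ) : 0 ≤ normVsq v :=
  Finset.sum_nonneg fun _ _ => sq_nonneg _

/-- First-order optimality along a segment. -/
theorem F_directional_nonneg {M N : ℕ} (α : ℝ) (f : Idx M N → ℝ) (p q : Idx M N → ℝ × ℝ)
    (h : ∀ θ : ℝ, 0 < θ → θ ≤ 1 → F α f p ≤ F α f (p + θ • q)) :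
    0 ≤ ∑ x, (divOp p x + α * f x) * divOp q x := by
  set c := ∑ x, (divOp p x + α * f x) * divOp q x with hc
  set e := (1 / 2) * normVsq (divOp q) with he
  have he0 : 0 ≤ e := mul_nonneg (by norm_num) (normVsq_nonneg _)
  have key : ∀ θ : ℝ, 0 < θ → θ ≤ 1 → 0 ≤ c + θ * e := fun θ h0 h1 => by
    have h2 := h θ h0 h1
    have hd : divOp (θ • q) = θ • divOp q := (divLin M N).map_smul θ q
    have hsum : ∑ x, (divOp p x + α * f x) * (θ • divOp q) x = θ * c := by
      rw [hc, Finset.mul_sum]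
      exact Finset.sum_congr rfl fun x _ => by simp; ring
    have hsq : (1 / 2) * normVsq (θ • divOp q) = θ ^ 2 * e := by
      simp only [he, normVsq, Finset.mul_sum, Pi.smul_apply, smul_eq_mul]
      exact Finset.sum_congr rfl fun x _ => by ring
    rw [F_add, hd, hsum, hsq] at h2
    have : 0 ≤ θ * (c + θ * e) := by nlinarith
    exact nonneg_of_mul_nonneg_right this h0
  by_contra hneg
  push Not at hneg
  have h1 := key (min 1 (-c / (2 * (e + 1)))) (lt_min one_pos (by apply div_pos <;> linarith))
    (min_le_left _ _)
  have h2 : min 1 (-c / (2 * (e + 1))) * e ≤ -c / (2 * (e + 1)) * e :=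
    mul_le_mul_of_nonneg_right (min_le_right _ _) he0
  have h3 : -c / (2 * (e + 1)) * e ≤ -c / 2 := by
    rw [div_mul_eq_mul_div, div_le_div_iff₀ (by linarith) (by norm_num)]
    nlinarith
  linarith

theorem mem_Cset_iff {M N : ℕ} {p : Idx M N → ℝ × ℝ} :
    p ∈ Cset M N ↔ ∀ x, (p x).1 ^ 2 + (p x).2 ^ 2 ≤ 1 := by
  simp [Cset, Real.sqrt_le_iff]

theorem Cset_segment {M N : ℕ} {p q : Idx M N → ℝ × ℝ} (hp : p ∈ Cset M N) (hq : q ∈ Cset M N)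
    {θ : ℝ} (h0 : 0 ≤ θ) (h1 : θ ≤ 1) : p + θ • (q - p) ∈ Cset M N := by
  rw [mem_Cset_iff] at *
  intro x
  have hp := hp x
  have hq := hq x
  simp only [Pi.add_apply, Pi.smul_apply, Pi.sub_apply, Prod.fst_add, Prod.snd_add,
    Prod.smul_fst, Prod.smul_snd, Prod.fst_sub, Prod.snd_sub, smul_eq_mul]
  nlinarith [mul_nonneg h0 (sub_nonneg.2 h1),
    mul_nonneg (mul_nonneg h0 (sub_nonneg.2 h1)) (sq_nonneg ((q x).1 - (p x).1)),
    mul_nonneg (mul_nonneg h0 (sub_nonneg.2 h1)) (sq_nonneg ((q x).2 - (p x).2)),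
    mul_le_mul_of_nonneg_left hq h0, mul_le_mul_of_nonneg_left hp (sub_nonneg.2 h1)]

theorem F_quadratic_growth {M N : ℕ} {α : ℝ} {f : Idx M N → ℝ} {z : Idx M N → ℝ × ℝ}
    (hz : z ∈ Cset M N) (hmin : ∀ r ∈ Cset M N, F α f z ≤ F α f r)
    {p : Idx M N → ℝ × ℝ} (hp : p ∈ Cset M N) :
    (1 / 2) * normVsq (divOp (p - z)) ≤ F α f p - F α f z := by
  have h := F_directional_nonneg α f z (p - z) fun θ h0 h1 =>
    hmin _ (Cset_segment hz hp h0.le h1)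
  have h2 := F_add α f z (p - z)
  rw [add_sub_cancel] at h2
  linarith

theorem Fk_relaxed {M N : ℕ} (α : ℝ) (f : Idx M N → ℝ) (S : Finset (Idx M N)) (c : ℝ)
    (r q : Idx M N → ℝ × ℝ) :
    Fk α f S (c • Rk S r - (c - 1) • Rk S q) q = F α f (q + c • projk S (r - q)) := by
  unfold Fk
  congr 1
  funext x
  by_cases hx : x ∈ S
  · simp only [Ek, Rk, projk, Pi.add_apply, Pi.sub_apply, Pi.smul_apply, hx, dif_pos, if_pos]
    module
  · simp [Ek, projk, hx]

theorem sum_projk {M N Nc : ℕ} {S : Fin Nc → Finset (Idx M N)}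
    (hdisj : ∀ k l, k ≠ l → Disjoint (S k) (S l)) (hcover : ∀ x : Idx M N, ∃ k, x ∈ S k)
    (p : Idx M N → ℝ × ℝ) : ∑ k, projk (S k) p = p := by
  funext x
  obtain ⟨k, hk⟩ := hcover x
  rw [Finset.sum_apply, Finset.sum_eq_single k]
  · simp [projk, hk]
  · intro l _ hl
    simp [projk, Finset.disjoint_left.1 (hdisj k l hl.symm) hk]
  · simp

theorem Rk_sum_Ek {M N Nc : ℕ} {S : Fin Nc → Finset (Idx M N)}
    (hdisj : ∀ k l, k ≠ l → Disjoint (S k) (S l))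
    (t : ∀ k : Fin Nc, {x // x ∈ S k} → ℝ × ℝ) (k : Fin Nc) :
    Rk (S k) (∑ l, Ek (S l) (t l)) = t k := by
  funext ⟨x, hx⟩
  simp only [Rk, Finset.sum_apply]
  rw [Finset.sum_eq_single k]
  · simp [Ek, hx]
  · intro l _ hl
    simp [Ek, Finset.disjoint_left.1 (hdisj k l hl.symm) hx]
  · simp

/-- The form of the preconditioner `N_c Σ_k R_k* R_k div* div R_k* R_k - div* div`. -/
def jacobiForm {M N Nc : ℕ} (S : Fin Nc → Finset (Idx M N)) :
    LinearMap.BilinForm ℝ (Idx M N → ℝ × ℝ) :=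
  (Nc : ℝ) • ∑ k, gramForm (divLin M N ∘ₗ projLin (S k)) - gramForm (divLin M N)

theorem jacobiForm_apply {M N Nc : ℕ} (S : Fin Nc → Finset (Idx M N))
    (p q : Idx M N → ℝ × ℝ) :
    jacobiForm S p q = (Nc : ℝ) * ∑ k, ∑ x, divOp (projk (S k) p) x * divOp (projk (S k) q) x
      - ∑ x, divOp p x * divOp q x := by
  simp only [jacobiForm, LinearMap.sub_apply, LinearMap.smul_apply, LinearMap.sum_apply,
    gramForm_apply, smul_eq_mul]
  rfl

theorem jacobiForm_symm {M N Nc : ℕ} (S : Fin Nc → Finset (Idx M N))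
    (p q : Idx M N → ℝ × ℝ) : jacobiForm S p q = jacobiForm S q p := by
  simp only [jacobiForm_apply, mul_comm]

theorem sum_divOp_projk {M N Nc : ℕ} {S : Fin Nc → Finset (Idx M N)}
    (hdisj : ∀ k l, k ≠ l → Disjoint (S k) (S l)) (hcover : ∀ x : Idx M N, ∃ k, x ∈ S k)
    (p : Idx M N → ℝ × ℝ) (x : Idx M N) : ∑ k, divOp (projk (S k) p) x = divOp p x := by
  have h : divOp (∑ k, projk (S k) p) = ∑ k, divOp (projk (S k) p) :=
    map_sum (divLin M N) _ _
  rw [sum_projk hdisj hcover] at h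
  rw [h, Finset.sum_apply]

theorem jacobiForm_nonneg {M N Nc : ℕ} {S : Fin Nc → Finset (Idx M N)}
    (hdisj : ∀ k l, k ≠ l → Disjoint (S k) (S l)) (hcover : ∀ x : Idx M N, ∃ k, x ∈ S k)
    (p : Idx M N → ℝ × ℝ) : 0 ≤ jacobiForm S p p := by
  rw [jacobiForm_apply, sub_nonneg, Finset.sum_comm, Finset.mul_sum]
  refine Finset.sum_le_sum fun x _ => ?_
  rw [← sum_divOp_projk hdisj hcover p x]
  have h := sq_sum_le_card_mul_sum_sq (s := Finset.univ)
    (f := fun k => divOp (projk (S k) p) x)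
  simpa [sq] using h

/-- The pre-relaxed block Jacobi update is a proximal point step for `jacobiForm`. -/
theorem jacobi_step_variational {M N Nc : ℕ} {α : ℝ} {f : Idx M N → ℝ}
    {S : Fin Nc → Finset (Idx M N)}
    (hdisj : ∀ k l, k ≠ l → Disjoint (S k) (S l)) (hcover : ∀ x : Idx M N, ∃ k, x ∈ S k)
    {p q : Idx M N → ℝ × ℝ} (hq : q ∈ Cset M N)
    (hmin : ∀ k, ∀ r ∈ Cset M N, F α f (p + (Nc : ℝ) • projk (S k) (q - p))
      ≤ F α f (p + (Nc : ℝ) • projk (S k) (r - p)))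
    {r : Idx M N → ℝ × ℝ} (hr : r ∈ Cset M N) :
    F α f q ≤ F α f r + jacobiForm S (q - p) (r - q) := by
  rcases Nat.eq_zero_or_pos Nc with h0 | hNc
  · subst h0
    have hemp : IsEmpty (Idx M N) := ⟨fun x => (hcover x).elim fun k _ => k.elim0⟩
    simp [F, normVsq, jacobiForm_apply]
  have hNc' : (0 : ℝ) < Nc := by exact_mod_cast hNc
  have hk : ∀ k, 0 ≤ ∑ x, (divOp p x + Nc * divOp (projk (S k) (q - p)) x + α * f x)
      * divOp (projk (S k) (r - q)) x := fun k => by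
    have h := F_directional_nonneg α f (p + (Nc : ℝ) • projk (S k) (q - p))
      ((Nc : ℝ) • projk (S k) (r - q)) fun θ h0 h1 => by
        have h2 := hmin k _ (Cset_segment hq hr h0.le h1)
        have h3 : p + (Nc : ℝ) • projk (S k) (q + θ • (r - q) - p)
            = p + (Nc : ℝ) • projk (S k) (q - p) + θ • (Nc : ℝ) • projk (S k) (r - q) := by
          have h4 : projk (S k) (q + θ • (r - q) - p)
              = projk (S k) (q - p) + θ • projk (S k) (r - q) := by
            rw [show q + θ • (r - q) - p = (q - p) + θ • (r - q) by abel]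
            exact ((projLin (S k)).map_add _ _).trans
              (congrArg _ ((projLin (S k)).map_smul _ _))
          rw [h4]
          module
        rwa [h3] at h2
    have hd : divOp (p + (Nc : ℝ) • projk (S k) (q - p))
        = divOp p + (Nc : ℝ) • divOp (projk (S k) (q - p)) :=
      ((divLin M N).map_add _ _).trans (congrArg _ ((divLin M N).map_smul _ _))
    have hd' : divOp ((Nc : ℝ) • projk (S k) (r - q))
        = (Nc : ℝ) • divOp (projk (S k) (r - q)) := (divLin M N).map_smul _ _
    simp only [hd, hd', Pi.add_apply, Pi.smul_apply, smul_eq_mul, mul_left_comm _ (Nc : ℝ),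
      ← Finset.mul_sum] at h
    exact nonneg_of_mul_nonneg_right h hNc'
  have hsum := Finset.sum_nonneg fun k (_ : k ∈ Finset.univ) => hk k
  have hdq : ∀ x, divOp q x = divOp p x + divOp (q - p) x := fun x => by
    have := (divLin M N).map_add p (q - p)
    rw [add_sub_cancel] at this
    exact congrFun this x
  have hF := F_add α f q (r - q)
  rw [add_sub_cancel] at hF
  have hnn := normVsq_nonneg (divOp (r - q))
  have key : ∑ k, ∑ x, (divOp p x + Nc * divOp (projk (S k) (q - p)) x + α * f x)
      * divOp (projk (S k) (r - q)) x
      = ∑ x, (divOp q x + α * f x) * divOp (r - q) x + jacobiForm S (q - p) (r - q) := by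
    rw [jacobiForm_apply, Finset.sum_comm, Finset.sum_comm (s := (Finset.univ : Finset (Fin Nc))),
      Finset.mul_sum, ← Finset.sum_sub_distrib, ← Finset.sum_add_distrib]
    refine Finset.sum_congr rfl fun x _ => ?_
    rw [hdq x, Finset.mul_sum]
    have h1 : (divOp p x + divOp (q - p) x + α * f x) * divOp (r - q) x
        - divOp (q - p) x * divOp (r - q) x
        = ∑ k, (divOp p x + α * f x) * divOp (projk (S k) (r - q)) x := by
      rw [← Finset.mul_sum, sum_divOp_projk hdisj hcover]
      ring
    rw [add_sub, add_sub_right_comm, h1, ← Finset.sum_add_distrib]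
    exact Finset.sum_congr rfl fun k _ => by ring
  linarith

theorem sum_colored_sq_sub_sq_le {κ : Type*} [Fintype κ] [DecidableEq κ] (i j k : κ) {a b c R : ℝ}
    (ha : a ^ 2 ≤ 2 * R) (hb : b ^ 2 ≤ R) (hc : c ^ 2 ≤ R) :
    ∑ l, ((if l = i then a else 0) + (if l = j then b else 0) + (if l = k then c else 0)) ^ 2
      - (a + b + c) ^ 2 ≤ 6 * R := by
  have h : ∀ l, ((if l = i then a else 0) + (if l = j then b else 0)
      + (if l = k then c else 0)) ^ 2
      = (if l = i then a ^ 2 + (if i = j then 2 * a * b else 0)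
          + (if i = k then 2 * a * c else 0) else 0)
        + (if l = j then b ^ 2 + (if j = k then 2 * b * c else 0) else 0)
        + (if l = k then c ^ 2 else 0) := by
    intro l
    split_ifs <;> first | (exfalso; grind) | ring
  simp only [h, Finset.sum_add_distrib, Finset.sum_ite_eq', Finset.mem_univ, if_true]
  split_ifs <;> nlinarith [sq_nonneg (a + b + c), sq_nonneg (b - c), sq_nonneg (a + b),
    sq_nonneg (a + c), sq_nonneg (b + c), sq_nonneg (a + b - c), sq_nonneg (a - b + c)]

theorem sum_mod_eq_zero_indicator (A m : ℕ) (hm : 0 < m) :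
    ∑ i : Fin (A * m), (if (i : ℕ) % m = 0 then (1 : ℝ) else 0) = A := by
  rw [Fin.sum_univ_eq_sum_range (fun i => if i % m = 0 then (1 : ℝ) else 0)]
  induction A with
  | zero => simp
  | succ A ih =>
    rw [Nat.succ_mul, Finset.sum_range_add, ih, Finset.sum_eq_single_of_mem 0 (by simpa using hm)]
    · simp
    · intro j hj hj0
      rw [Nat.mul_add_mod_self_right, Nat.mod_eq_of_lt (Finset.mem_range.1 hj), if_neg hj0]

/-- The number of pixels on the upper or left edge of a block. -/
theorem sum_block_edge (A B m n : ℕ) (hm : 0 < m) (hn : 0 < n) :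
    ∑ x : Idx (A * m) (B * n),
      (if (x.1 : ℕ) % m = 0 ∨ (x.2 : ℕ) % n = 0 then (1 : ℝ) else 0)
      = A * (B * n) + (A * m) * B - A * B := by
  set u : Fin (A * m) → ℝ := fun i => if (i : ℕ) % m = 0 then 1 else 0 with hu
  set v : Fin (B * n) → ℝ := fun j => if (j : ℕ) % n = 0 then 1 else 0 with hv
  have hsu : ∑ i, u i = A := sum_mod_eq_zero_indicator A m hm
  have hsv : ∑ j, v j = B := sum_mod_eq_zero_indicator B n hn
  have h : ∀ x : Idx (A * m) (B * n),
      (if (x.1 : ℕ) % m = 0 ∨ (x.2 : ℕ) % n = 0 then (1 : ℝ) else 0)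
      = u x.1 + v x.2 - u x.1 * v x.2 := by
    intro x
    simp only [hu, hv]
    split_ifs <;> simp_all
  have hprod : ∑ i, ∑ j, u i * v j = A * B := by rw [← Finset.sum_mul_sum, hsu, hsv]
  simp only [h, Finset.sum_sub_distrib, Finset.sum_add_distrib, Fintype.sum_prod_type, hprod]
  simp only [hsv, Finset.sum_const, Finset.card_univ, Fintype.card_fin, nsmul_eq_mul,
    ← Finset.mul_sum, hsu]
  push_cast
  ring

theorem block_divOp_sq_le {M N Ms Ns m n Nc : ℕ} {S : Fin Nc → Finset (Idx M N)}
    (hdisj : ∀ k l, k ≠ l → Disjoint (S k) (S l)) (hcover : ∀ x : Idx M N, ∃ k, x ∈ S k)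
    (hunion : ∀ k, ∃ B : Finset (Fin Ms × Fin Ns), S k = B.biUnion (block m n))
    {d : Idx M N → ℝ × ℝ} {R : ℝ} (hd : ∀ x, (d x).1 ^ 2 + (d x).2 ^ 2 ≤ R) (x : Idx M N) :
    ∑ k, divOp (projk (S k) d) x ^ 2 ≤ divOp d x ^ 2
      + 6 * R * (if (x.1 : ℕ) % m = 0 ∨ (x.2 : ℕ) % n = 0 then 1 else 0) := by
  choose col hcol using hcover
  have hmem : ∀ k y, y ∈ S k ↔ k = col y := fun k y => by
    refine ⟨fun hy => ?_, fun h => h ▸ hcol y⟩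
    by_contra hne
    exact Finset.disjoint_left.1 (hdisj _ _ hne) hy (hcol y)
  have hsame : ∀ y : Idx M N, (x.1 : ℕ) / m = (y.1 : ℕ) / m → (x.2 : ℕ) / n = (y.2 : ℕ) / n →
      col y = col x := fun y h1 h2 => by
    obtain ⟨B, hB⟩ := hunion (col x)
    have hx := hcol x
    rw [eq_comm, ← hmem, hB]
    rw [hB] at hx
    simp only [Finset.mem_biUnion, block, Finset.mem_filter, Finset.mem_univ, true_and] at hx ⊢
    rwa [← h1, ← h2]
  have hpred : ∀ i l : ℕ, i % l ≠ 0 → i / l = (i - 1) / l := fun i l h => by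
    obtain ⟨i, rfl⟩ : ∃ j, i = j + 1 := ⟨i - 1, by rcases i with _ | i <;> simp_all⟩
    rw [Nat.succ_div, if_neg fun h' => h (Nat.mod_eq_zero_of_dvd h')]
    simp
  have hfst : ∀ y, (d y).1 ^ 2 ≤ R := fun y => by nlinarith [hd y, sq_nonneg (d y).2]
  have hsnd : ∀ y, (d y).2 ^ 2 ≤ R := fun y => by nlinarith [hd y, sq_nonneg (d y).1]
  have hR : 0 ≤ R := (sq_nonneg _).trans (hfst x)
  set y : Idx M N := (⟨(x.1 : ℕ) - 1, lt_of_le_of_lt (Nat.sub_le _ _) x.1.isLt⟩, x.2) with hy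
  set z : Idx M N := (x.1, ⟨(x.2 : ℕ) - 1, lt_of_le_of_lt (Nat.sub_le _ _) x.2.isLt⟩) with hz
  set a : ℝ := (if (x.1 : ℕ) + 1 < M then (d x).1 else 0)
    + (if (x.2 : ℕ) + 1 < N then (d x).2 else 0) with ha
  set b : ℝ := -(if 1 ≤ (x.1 : ℕ) then (d y).1 else 0) with hb
  set c : ℝ := -(if 1 ≤ (x.2 : ℕ) then (d z).2 else 0) with hc
  have hdiv : divOp d x = a + b + c := by
    simp only [divOp, ha, hb, hc, ← hy, ← hz]
    ring
  have hproj : ∀ k, divOp (projk (S k) d) x = (if k = col x then a else 0)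
      + (if k = col y then b else 0) + (if k = col z then c else 0) := fun k => by
    simp only [divOp, projk, hmem, ha, hb, hc, ← hy, ← hz]
    split_ifs <;> (try simp only [Prod.fst_zero, Prod.snd_zero]) <;> ring
  simp only [hproj, hdiv]
  split_ifs with hedge
  · have ha2 : a ^ 2 ≤ 2 * R := by
      simp only [ha]
      split_ifs <;> nlinarith [hd x, hfst x, hsnd x, sq_nonneg ((d x).1 - (d x).2)]
    have hb2 : b ^ 2 ≤ R := by
      simp only [hb]
      split_ifs <;> simp [hfst, hR]
    have hc2 : c ^ 2 ≤ R := by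
      simp only [hc]
      split_ifs <;> simp [hsnd, hR]
    linarith [sum_colored_sq_sub_sq_le (col x) (col y) (col z) ha2 hb2 hc2]
  · push Not at hedge
    rw [hsame y (hpred _ _ hedge.1) rfl, hsame z rfl (hpred _ _ hedge.2)]
    have h : ∀ k, ((if k = col x then a else 0) + (if k = col x then b else 0)
        + (if k = col x then c else 0)) ^ 2 = if k = col x then (a + b + c) ^ 2 else 0 :=
      fun k => by split_ifs <;> ring
    simp [h]

theorem prerelaxed_jacobi_explicit_rate (M N Ms Ns m n : ℕ) (hm : 0 < m) (hn : 0 < n)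
    (hM : M = Ms * m) (hN : N = Ns * n)
    (α : ℝ) (hα : 0 < α) (f : Idx M N → ℝ)
    (Nc : ℕ) (S : Fin Nc → Finset (Idx M N))
    (hdisj : ∀ k l, k ≠ l → Disjoint (S k) (S l))
    (hcover : ∀ x : Idx M N, ∃ k, x ∈ S k)
    (hunion : ∀ k, ∃ B : Finset (Fin Ms × Fin Ns), S k = B.biUnion (block m n))
    (p : ℕ → Idx M N → ℝ × ℝ) (hp0 : p 0 ∈ Cset M N)
    (t : ∀ _ : ℕ, ∀ k : Fin Nc, {x // x ∈ S k} → ℝ × ℝ)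
    (ht : ∀ n k, t n k ∈ Ck (S k))
    (hmin : ∀ n k, ∀ rk ∈ Ck (S k),
      Fk α f (S k) ((Nc : ℝ) • t n k - ((Nc : ℝ) - 1) • Rk (S k) (p n)) (p n)
        ≤ Fk α f (S k) ((Nc : ℝ) • rk - ((Nc : ℝ) - 1) • Rk (S k) (p n)) (p n))
    (hrec : ∀ n, p (n + 1) = ∑ k, Ek (S k) (t n k))
    (pstar : Idx M N → ℝ × ℝ) (hpstar : pstar ∈ Cset M N)
    (hstar : ∀ r ∈ Cset M N, F α f pstar ≤ F α f r)
    : ∀ n : ℕ, 1 ≤ n →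
      F α f (p n) - F α f pstar ≤
        ((Nc : ℝ) / (n : ℝ)) *
          (F α f (p 0) - F α f pstar + 2 * (7 * ((M : ℝ) * (Ns : ℝ) + (Ms : ℝ) * (N : ℝ) - (11 / 7) * ((Ms : ℝ) * (Ns : ℝ))))) := by
  subst hM hN
  have hR : ∀ i k, t i k = Rk (S k) (p (i + 1)) := fun i k => by
    rw [hrec, Rk_sum_Ek hdisj]
  have hpC : ∀ i, p i ∈ Cset (Ms * m) (Ns * n) := fun i => by
    rcases i with _ | i
    · exact hp0
    · intro x
      obtain ⟨k, hk⟩ := hcover x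
      obtain ⟨r, hr, hrt⟩ := ht i k
      have h : r x = p (i + 1) x := congrFun (hrt.trans (hR i k)) ⟨x, hk⟩
      rw [← h]
      exact hr x
  have hvar : ∀ i, ∀ r ∈ Cset (Ms * m) (Ns * n),
      F α f (p (i + 1)) ≤ F α f r + jacobiForm S (p (i + 1) - p i) (r - p (i + 1)) :=
    fun i r hr => jacobi_step_variational hdisj hcover (hpC (i + 1)) (fun k r' hr' => by
      have h := hmin i k (Rk (S k) r') ⟨r', hr', rfl⟩
      rwa [hR, Fk_relaxed, Fk_relaxed] at h) hr
  intro j hj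
  have hrate := proximal_point_rate (jacobiForm S) (jacobiForm_symm S)
    (jacobiForm_nonneg hdisj hcover) (F α f) (Cset (Ms * m) (Ns * n)) p hpC hvar pstar hpstar j
  have hgrow := F_quadratic_growth hpstar hstar (hpC 0)
  have hd : ∀ x, ((p 0 - pstar) x).1 ^ 2 + ((p 0 - pstar) x).2 ^ 2 ≤ 4 := fun x => by
    have h1 := mem_Cset_iff.1 hp0 x
    have h2 := mem_Cset_iff.1 hpstar x
    simp only [Pi.sub_apply, Prod.fst_sub, Prod.snd_sub]
    nlinarith [sq_nonneg ((p 0 x).1 + (pstar x).1), sq_nonneg ((p 0 x).2 + (pstar x).2)]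
  have hblock := Finset.sum_le_sum fun x (_ : x ∈ Finset.univ) =>
    block_divOp_sq_le hdisj hcover hunion hd x
  rw [Finset.sum_add_distrib, ← Finset.mul_sum, sum_block_edge Ms Ns m n hm hn] at hblock
  have hsq := normVsq_nonneg (divOp (p 0 - pstar))
  rw [jacobiForm_apply, Finset.sum_comm] at hrate
  simp only [← sq] at hrate
  simp only [normVsq] at hgrow hsq
  have hj' : (0 : ℝ) < j := by exact_mod_cast hj
  have hNc : (0 : ℝ) ≤ Nc := Nat.cast_nonneg Nc
  have hA : (Ms : ℝ) * Ns ≤ Ms * (Ns * n) := by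
    have : (1 : ℝ) ≤ n := by exact_mod_cast hn
    exact mul_le_mul_of_nonneg_left (le_mul_of_one_le_right (by positivity) this) (by positivity)
  have hB : (Ms : ℝ) * Ns ≤ Ms * m * Ns := by
    have : (1 : ℝ) ≤ m := by exact_mod_cast hm
    exact mul_le_mul_of_nonneg_right (le_mul_of_one_le_right (by positivity) this) (by positivity)
  rw [div_mul_eq_mul_div, le_div_iff₀ hj']
  push_cast
  have hbound := mul_le_mul_of_nonneg_left (a := (Nc : ℝ))
    (b := ∑ x, ∑ k, divOp (projk (S k) (p 0 - pstar)) x ^ 2)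
    (c := 4 * (F α f (p 0) - F α f pstar + 2 * (7 * ((Ms : ℝ) * m * Ns + Ms * (Ns * n)
      - 11 / 7 * (Ms * Ns))))) (by linarith) hNc
  linarith
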